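/- arXiv:1210.6330 — 4 statements merged into one kernel-verified Lean document; each statement's English description precedes it below -/
import Mathlib

section
/- Under the Poincaré inequality, B restricted to (ker B)^⊥ is a bijection onto (ker B)^⊥: for every v ∈ (ker B)^⊥ there exists a unique u ∈ dom B with u ∈ (ker B)^⊥ and Bu = v; moreover this u satisfies ‖u‖ ≤ C_P ‖v‖. -/
open InnerProductSpace

/-- Let `B` be a densely defined skew-adjoint operator on a real Hilbert
space `H` (skew-adjointness is encoded by the skew-symmetry of `B` together with the
maximality property characterizing `dom B* = dom B`, `B* = -B`).  Let `N = ker B` and let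
`Pproj` be the orthogonal projection onto `N`.  Under the Poincaré inequality
`‖u - Pproj u‖ ≤ C_P ‖B u‖` on `dom B`, the operator `B` restricted to `(ker B)ᗮ` is a
bijection onto `(ker B)ᗮ`: it maps `dom B ∩ Nᗮ` into `Nᗮ`, and for every `v ∈ Nᗮ` there
is a unique `u ∈ dom B` with `u ∈ Nᗮ` and `B u = v`; moreover `‖u‖ ≤ C_P ‖v‖`. -/
theorem skew_adjoint_restricted_bijection
    {H : Type*} [NormedAddCommGroup H] [InnerProductSpace ℝ H] [CompleteSpace H]
    (dom : Submodule ℝ H) (hdense : Dense (dom : Set H))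
    (B : dom →ₗ[ℝ] H)
    (hskew : ∀ u v : dom, inner (𝕜 := ℝ) (B u) (v : H) = - inner (𝕜 := ℝ) (u : H) (B v))
    (hmax : ∀ v w : H, (∀ u : dom, inner (𝕜 := ℝ) (B u) v = inner (𝕜 := ℝ) (u : H) w) →
      ∃ hv : v ∈ dom, w = - B ⟨v, hv⟩)
    (N : Submodule ℝ H)
    (hN : ∀ x : H, x ∈ N ↔ ∃ hx : x ∈ dom, B ⟨x, hx⟩ = 0)
    (Pproj : H → H)
    (hPproj : ∀ x : H, Pproj x ∈ N ∧ ∀ w ∈ N, inner (𝕜 := ℝ) (x - Pproj x) w = 0)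
    (CP : ℝ) (hCP : 0 < CP)
    (hPoincare : ∀ u : dom, ‖(u : H) - Pproj u‖ ≤ CP * ‖B u‖) :
    (∀ u : dom, (u : H) ∈ Nᗮ → B u ∈ Nᗮ) ∧
    (∀ v : H, v ∈ Nᗮ →
      (∃ u : dom, (u : H) ∈ Nᗮ ∧ B u = v ∧ ‖(u : H)‖ ≤ CP * ‖v‖) ∧
      (∀ u₁ u₂ : dom, (u₁ : H) ∈ Nᗮ → (u₂ : H) ∈ Nᗮ → B u₁ = v → B u₂ = v → u₁ = u₂)) := by
  have horth : ∀ x : H, x - Pproj x ∈ Nᗮ := fun x => by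
    rw [Submodule.mem_orthogonal']
    exact (hPproj x).2
  have hBN : ∀ u : dom, B u ∈ Nᗮ := by
    intro u
    rw [Submodule.mem_orthogonal']
    intro w hw
    obtain ⟨hx, h0⟩ := (hN w).1 hw
    have := hskew u ⟨w, hx⟩
    rw [h0] at this
    simpa using this
  refine ⟨fun u _ => hBN u, fun v hv => ⟨?_, ?_⟩⟩
  · have hv' := (Submodule.mem_orthogonal' N v).1 hv
    have key : ∀ w : dom, |inner (𝕜 := ℝ) v (w : H)| ≤ (CP * ‖v‖) * ‖B w‖ := by
      intro w
      have h1 : inner (𝕜 := ℝ) v (w : H) = inner (𝕜 := ℝ) v ((w : H) - Pproj w) := by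
        rw [inner_sub_right, hv' _ (hPproj w).1, sub_zero]
      rw [h1]
      calc _ ≤ ‖v‖ * ‖(w : H) - Pproj w‖ := abs_real_inner_le_norm _ _
        _ ≤ ‖v‖ * (CP * ‖B w‖) := by gcongr; exact hPoincare w
        _ = _ := by ring
    have wd : ∀ w w' : dom, B w = B w' →
        inner (𝕜 := ℝ) v (w : H) = inner (𝕜 := ℝ) v (w' : H) := by
      intro w w' h
      have := key (w - w')
      rw [map_sub, h, sub_self, norm_zero, mul_zero] at this
      have h2 := abs_nonpos_iff.1 this
      rw [Submodule.coe_sub, inner_sub_right] at h2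
      linarith
    choose s hs using fun y : LinearMap.range B => y.2
    let f : LinearMap.range B →ₗ[ℝ] ℝ :=
      { toFun := fun y => inner (𝕜 := ℝ) v (s y : H)
        map_add' := fun x y => by
          rw [← inner_add_right, ← Submodule.coe_add]
          apply wd
          rw [map_add, hs, hs, hs]; rfl
        map_smul' := fun c x => by
          rw [RingHom.id_apply, smul_eq_mul, ← real_inner_smul_right, ← Submodule.coe_smul]
          apply wd
          rw [map_smul, hs, hs]; rfl }
    let F : StrongDual ℝ (LinearMap.range B) := f.mkContinuous (CP * ‖v‖) (fun y => by
      have := key (s y)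
      rw [hs] at this
      exact this)
    obtain ⟨g, hg, -⟩ := _root_.exists_extension_norm_eq (LinearMap.range B) F
    have hgB : ∀ w : dom, g (B w) = inner (𝕜 := ℝ) v (w : H) := by
      intro w
      have h1 := hg ⟨B w, LinearMap.mem_range_self B w⟩
      exact h1.trans (wd _ _ (hs _))
    obtain ⟨hx, hB⟩ := hmax ((toDual ℝ H).symm g) v (fun u => by
      rw [real_inner_comm, toDual_symm_apply, hgB, real_inner_comm])
    set x := (toDual ℝ H).symm g
    obtain ⟨hp, hp0⟩ := (hN _).1 (hPproj (-x)).1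
    have hBu : B (⟨-x, dom.neg_mem hx⟩ - ⟨Pproj (-x), hp⟩) = v := by
      rw [map_sub, hp0, sub_zero]; exact (B.map_neg ⟨x, hx⟩).trans hB.symm
    refine ⟨⟨-x, dom.neg_mem hx⟩ - ⟨Pproj (-x), hp⟩, horth (-x), hBu, ?_⟩
    have h3 := hPoincare ⟨-x, dom.neg_mem hx⟩
    rw [map_sub, hp0, sub_zero] at hBu
    rw [hBu] at h3
    exact h3
  · intro u₁ u₂ h1 h2 e1 e2
    have hn : ((u₁ - u₂ : dom) : H) ∈ N :=
      (hN _).2 ⟨(u₁ - u₂).2, by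
        change B (u₁ - u₂) = 0
        rw [map_sub, e1, e2, sub_self]⟩
    have ho : ((u₁ - u₂ : dom) : H) ∈ Nᗮ := Nᗮ.sub_mem h1 h2
    have := (Submodule.mem_orthogonal' N _).1 ho _ hn
    rw [inner_self_eq_zero] at this
    exact sub_eq_zero.1 (Subtype.ext this)
end

section
/- Define the operator T with domain dom T = {u ∈ dom B : Bu ∈ dom B} by Tu = −B(Bu). Then ker T = ker B, the range of T equals the range of B, which equals (ker B)^⊥, and ‖u − Pu‖ ≤ C_P² ‖Tu‖ for every u ∈ dom T. -/
open InnerProductSpace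

/-- With `B` a densely defined skew-adjoint operator on a real Hilbert
space `H`, `N = ker B`, `Pproj` the orthogonal projection onto `N`, and the Poincaré
inequality `‖u - Pproj u‖ ≤ C_P ‖B u‖` on `dom B`, consider the operator
`T u = -B(B u)` with domain `dom T = {u ∈ dom B : B u ∈ dom B}`.  Then `ker T = ker B`,
`ran T = ran B = (ker B)ᗮ`, and `‖u - Pproj u‖ ≤ C_P² ‖T u‖` for every `u ∈ dom T`. -/
theorem square_operator_kernel_range_poincare
    {H : Type*} [NormedAddCommGroup H] [InnerProductSpace ℝ H] [CompleteSpace H]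
    (dom : Submodule ℝ H) (hdense : Dense (dom : Set H))
    (B : dom →ₗ[ℝ] H)
    (hskew : ∀ u v : dom, inner (𝕜 := ℝ) (B u) (v : H) = - inner (𝕜 := ℝ) (u : H) (B v))
    (hmax : ∀ v w : H, (∀ u : dom, inner (𝕜 := ℝ) (B u) v = inner (𝕜 := ℝ) (u : H) w) →
      ∃ hv : v ∈ dom, w = - B ⟨v, hv⟩)
    (N : Submodule ℝ H)
    (hN : ∀ x : H, x ∈ N ↔ ∃ hx : x ∈ dom, B ⟨x, hx⟩ = 0)
    (Pproj : H → H)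
    (hPproj : ∀ x : H, Pproj x ∈ N ∧ ∀ w ∈ N, inner (𝕜 := ℝ) (x - Pproj x) w = 0)
    (CP : ℝ) (hCP : 0 < CP)
    (hPoincare : ∀ u : dom, ‖(u : H) - Pproj u‖ ≤ CP * ‖B u‖) :
    -- kernel of T equals kernel of B
    ({u : H | ∃ (hu : u ∈ dom) (hu₂ : B ⟨u, hu⟩ ∈ dom), - B ⟨B ⟨u, hu⟩, hu₂⟩ = 0}
        = (N : Set H)) ∧
    -- range of T equals range of B
    ({v : H | ∃ (u : H) (hu : u ∈ dom) (hu₂ : B ⟨u, hu⟩ ∈ dom), - B ⟨B ⟨u, hu⟩, hu₂⟩ = v}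
        = {v : H | ∃ u : dom, B u = v}) ∧
    -- range of B equals (ker B)ᗮ
    ({v : H | ∃ u : dom, B u = v} = (Nᗮ : Set H)) ∧
    -- iterated Poincaré inequality
    (∀ (u : H) (hu : u ∈ dom) (hu₂ : B ⟨u, hu⟩ ∈ dom),
      ‖u - Pproj u‖ ≤ CP ^ 2 * ‖- B ⟨B ⟨u, hu⟩, hu₂⟩‖) := by
  have hperp : ∀ (u : dom) (w : H), w ∈ N → inner (𝕜 := ℝ) (B u) w = 0 := by
    intro u w hw
    obtain ⟨hx, h0⟩ := (hN w).1 hw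
    have := hskew u ⟨w, hx⟩
    rw [h0, inner_zero_right, neg_zero] at this
    exact this
  have hfP : ∀ (f : H), f ∈ Nᗮ → ∀ u : H, inner (𝕜 := ℝ) f (u - Pproj u) = inner (𝕜 := ℝ) f u := by
    intro f hf u
    rw [inner_sub_right, (Submodule.mem_orthogonal' N f).1 hf _ (hPproj u).1, sub_zero]
  have hsurj : ∀ f : H, f ∈ Nᗮ → ∃ u : dom, B u = f := by
    intro f hf
    obtain ⟨g, hg⟩ := B.rangeRestrict.exists_rightInverse_of_surjective B.range_rangeRestrict
    have hg' : ∀ r : LinearMap.range B, B (g r) = r := fun r =>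
      congrArg Subtype.val (LinearMap.congr_fun hg r)
    let φ : LinearMap.range B →ₗ[ℝ] ℝ := (innerₛₗ ℝ f) ∘ₗ dom.subtype ∘ₗ g
    have hφ : ∀ r, φ r = inner (𝕜 := ℝ) f (g r : H) := fun r => rfl
    let ψ : LinearMap.range B →L[ℝ] ℝ := φ.mkContinuous (‖f‖ * CP) (by
      intro r
      rw [hφ, ← hfP f hf, mul_assoc]
      refine (norm_inner_le_norm _ _).trans ?_
      refine mul_le_mul_of_nonneg_left ?_ (norm_nonneg _)
      have := hPoincare (g r)
      rw [hg'] at this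
      exact this)
    obtain ⟨F, hF, -⟩ := exists_extension_norm_eq (LinearMap.range B) ψ
    obtain ⟨hv, hw⟩ := hmax ((InnerProductSpace.toDual ℝ H).symm F) f (by
      intro u
      rw [real_inner_comm, InnerProductSpace.toDual_symm_apply, real_inner_comm]
      have h1 : F (B u) = inner (𝕜 := ℝ) f (g ⟨B u, u, rfl⟩ : H) := hF ⟨B u, u, rfl⟩
      have h2 : ((g ⟨B u, u, rfl⟩ - u : dom) : H) ∈ N :=
        (hN _).2 ⟨(g ⟨B u, u, rfl⟩ - u : dom).2, by
          change B (g ⟨B u, u, rfl⟩ - u) = 0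
          rw [map_sub, hg', sub_self]⟩
      have h3 := (Submodule.mem_orthogonal' N f).1 hf _ h2
      rw [Submodule.coe_sub, inner_sub_right] at h3
      rw [h1]
      linarith)
    exact ⟨-⟨_, hv⟩, by rw [map_neg]; exact hw.symm⟩
  refine ⟨?_, ?_, ?_, ?_⟩
  · ext u
    constructor
    · rintro ⟨hu, hu₂, h⟩
      refine (hN u).2 ⟨hu, ?_⟩
      exact inner_self_eq_zero.1
        (hperp ⟨u, hu⟩ _ ((hN _).2 ⟨hu₂, neg_eq_zero.1 h⟩))
    · intro h
      obtain ⟨hu, h0⟩ := (hN u).1 h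
      have hu₂ : B ⟨u, hu⟩ ∈ dom := by rw [h0]; exact dom.zero_mem
      refine ⟨hu, hu₂, ?_⟩
      have : (⟨B ⟨u, hu⟩, hu₂⟩ : dom) = 0 := Subtype.ext h0
      rw [this, map_zero, neg_zero]
  · ext v
    constructor
    · rintro ⟨u, hu, hu₂, h⟩
      exact ⟨-⟨_, hu₂⟩, by rw [map_neg]; exact h⟩
    · rintro ⟨u, rfl⟩
      obtain ⟨hx, h0⟩ := (hN _).1 (hPproj (u : H)).1
      obtain ⟨w, hw⟩ := hsurj ((u : H) - Pproj u)
        ((Submodule.mem_orthogonal' N _).2 (hPproj (u : H)).2)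
      have e : B (-w) = ((⟨Pproj u, hx⟩ - u : dom) : H) := by
        rw [map_neg, hw, Submodule.coe_sub, neg_sub]
      have hm : B (-w) ∈ dom := by rw [e]; exact Subtype.property _
      refine ⟨((-w : dom) : H), (-w).2, hm, ?_⟩
      have e2 : (⟨B (-w), hm⟩ : dom) = ⟨Pproj u, hx⟩ - u := Subtype.ext e
      change -B ⟨B (-w), hm⟩ = B u
      rw [e2, map_sub, h0, zero_sub, neg_neg]
  · ext v
    constructor
    · rintro ⟨u, rfl⟩
      exact (Submodule.mem_orthogonal' N _).2 (hperp u)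
    · exact hsurj v
  · intro u hu hu₂
    have h1 := hPoincare ⟨u, hu⟩
    have h2 := hPoincare ⟨_, hu₂⟩
    have h3 : Pproj (B ⟨u, hu⟩) = 0 := by
      have a := (hPproj (B ⟨u, hu⟩)).2 _ (hPproj (B ⟨u, hu⟩)).1
      rw [inner_sub_left, hperp ⟨u, hu⟩ _ (hPproj (B ⟨u, hu⟩)).1, zero_sub, neg_eq_zero] at a
      exact inner_self_eq_zero.1 a
    simp only [h3, sub_zero] at h2
    rw [norm_neg, sq, mul_assoc]
    exact h1.trans (mul_le_mul_of_nonneg_left h2 hCP.le)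
end

section
/- Let c : ℝ^m → ℝ^m be a C¹ vector field. Then the following three statements are equivalent: (1) the Poisson bracket [b,c] := (b·∇_y)c − (∂_yb)c vanishes identically on ℝ^m; (2) for every s ∈ ℝ and all u, v ∈ C¹_c(ℝ^m), ∫_{ℝ^m} (c·∇_y u)(y) v(Y(−s;y)) dy = ∫_{ℝ^m} (c·∇_y (u∘Y(s;·)))(y) v(y) dy; (3) for every u ∈ C²_c(ℝ^m) and v ∈ C¹_c(ℝ^m), ∫_{ℝ^m} (c·∇_y u)(b·∇_y v) dy + ∫_{ℝ^m} (c·∇_y(b·∇_y u)) v dy = 0. -/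
open MeasureTheory

section ODE
variable {E : Type*} [NormedAddCommGroup E] [NormedSpace ℝ E] [ProperSpace E]

lemma aux_bound {b : E → E} {C : ℝ} (hC : 0 < C) (hgrow : ∀ y, ‖b y‖ ≤ C * (1 + ‖y‖))
    (M S : ℝ) (hM : 0 ≤ M) : ∃ R : ℝ, 0 ≤ R ∧ ∀ x : ℝ → E, (∀ t, HasDerivAt x (b (x t)) t) → ‖x 0‖ ≤ M →
      ∀ t ∈ Set.Icc 0 S, ‖x t‖ ≤ R := by
  refine ⟨max 0 (gronwallBound M C C S), le_max_left _ _, fun x hx h0 t ht => ?_⟩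
  have h := norm_le_gronwallBound_of_norm_deriv_right_le (f := x) (f' := fun t => b (x t)) (δ := M)
    (K := C) (ε := C) (a := 0) (b := S)
    (fun t _ => (hx t).continuousAt.continuousWithinAt) (fun t _ => (hx t).hasDerivWithinAt) h0
    (fun t _ => by have := hgrow (x t); linarith) t ht
  refine h.trans (le_trans ?_ (le_max_right _ _))
  exact gronwallBound_mono hM hC.le hC.le (by simpa using ht.2)

lemma aux_lip {b : E → E} (hb : ContDiff ℝ 1 b) (R : ℝ) :
    ∃ K : NNReal, LipschitzOnWith K b (Metric.closedBall 0 R) := by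
  obtain ⟨K, hK⟩ := (isCompact_closedBall (0 : E) R).exists_bound_of_continuousOn
    (hb.continuous_fderiv one_ne_zero).continuousOn
  refine ⟨K.toNNReal, Convex.lipschitzOnWith_of_nnnorm_fderiv_le (𝕜 := ℝ)
    (fun x _ => hb.differentiable one_ne_zero x) (fun x hx => ?_) (convex_closedBall _ _)⟩
  rw [← NNReal.coe_le_coe]
  exact (hK x hx).trans (Real.le_coe_toNNReal K)

lemma aux_unif {b : E → E} (hb : ContDiff ℝ 1 b) (R : ℝ) {ε : ℝ} (hε : 0 < ε) :
    ∃ η > 0, ∀ p ∈ Metric.closedBall (0 : E) R, ∀ q, ‖q - p‖ < η →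
      ‖b q - b p - fderiv ℝ b p (q - p)‖ ≤ ε * ‖q - p‖ := by
  have h := (isCompact_closedBall (0 : E) R).uniformContinuousAt_of_continuousAt (fderiv ℝ b)
    (fun a _ => (hb.continuous_fderiv one_ne_zero).continuousAt) (Metric.dist_mem_uniformity hε)
  obtain ⟨η, hη, h⟩ := Metric.mem_uniformity_dist.1 h
  refine ⟨η, hη, fun p hp q hq => ?_⟩
  refine Convex.norm_image_sub_le_of_norm_fderiv_le' (𝕜 := ℝ) (s := Metric.ball p η)
    (fun x _ => hb.differentiable one_ne_zero x) (fun x hx => ?_) (convex_ball _ _)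
    (Metric.mem_ball_self hη) (by simpa [dist_eq_norm] using hq)
  have := h (a := p) (b := x) (by rw [dist_comm]; exact hx) hp
  simp only [Set.mem_ofPred_eq] at this
  rw [← dist_eq_norm, dist_comm]
  exact this.le

lemma aux_unique {b : E → E} (hb : ContDiff ℝ 1 b) {x y : ℝ → E}
    (hx : ∀ t, HasDerivAt x (b (x t)) t) (hy : ∀ t, HasDerivAt y (b (y t)) t) (h0 : x 0 = y 0) :
    x = y := by
  funext t
  set T := |t| + 1 with hT
  have cx : Continuous x := continuous_iff_continuousAt.2 fun t => (hx t).continuousAt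
  have cy : Continuous y := continuous_iff_continuousAt.2 fun t => (hy t).continuousAt
  obtain ⟨A, hA⟩ := (isCompact_Icc (a := -T) (b := T)).exists_bound_of_continuousOn cx.continuousOn
  obtain ⟨B, hB⟩ := (isCompact_Icc (a := -T) (b := T)).exists_bound_of_continuousOn cy.continuousOn
  obtain ⟨K, hK⟩ := aux_lip hb (max A B)
  have := ODE_solution_unique_of_mem_Icc (v := fun _ => b) (s := fun _ => Metric.closedBall 0 (max A B))
    (K := K) (f := x) (g := y) (a := -T) (b := T) (t₀ := 0) (fun _ _ => hK)
    (by constructor <;> (have := abs_nonneg t; linarith)) cx.continuousOn (fun t _ => hx t)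
    (fun t ht => by
      simpa using (Or.inl (hA t ⟨ht.1.le, ht.2.le⟩) : _ ∨ ‖x t‖ ≤ B))
    cy.continuousOn (fun t _ => hy t)
    (fun t ht => by
      simpa using (Or.inr (hB t ⟨ht.1.le, ht.2.le⟩) : ‖y t‖ ≤ A ∨ _)) h0
  exact this ⟨by have := neg_abs_le t; linarith, by have := le_abs_self t; linarith⟩

lemma aux_push_fwd {b c : E → E} {C : ℝ} (hb : ContDiff ℝ 1 b) (hc : ContDiff ℝ 1 c)
    (hC : 0 < C) (hgrow : ∀ y, ‖b y‖ ≤ C * (1 + ‖y‖))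
    (Y : ℝ → E → E) (hY0 : ∀ y, Y 0 y = y)
    (hYd : ∀ (s : ℝ) (y : E), HasDerivAt (fun t => Y t y) (b (Y s y)) s)
    (hYs : ∀ s : ℝ, ContDiff ℝ 1 (Y s))
    (hbr : ∀ y, fderiv ℝ c y (b y) = fderiv ℝ b y (c y)) (S : ℝ) (hS : 0 ≤ S) (y : E) :
    fderiv ℝ (Y S) y (c y) = c (Y S y) := by
  have cx : Continuous fun t => Y t y := continuous_iff_continuousAt.2 fun t => (hYd t y).continuousAt
  have ce : Continuous fun t => c (Y t y) := hc.continuous.comp cx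
  obtain ⟨M, hM⟩ := (isCompact_Icc (a := 0) (b := S)).exists_bound_of_continuousOn ce.continuousOn
  have hM0 : 0 ≤ M := (norm_nonneg _).trans (hM 0 ⟨le_rfl, hS⟩)
  obtain ⟨R, hR0, hR⟩ := aux_bound hC hgrow (‖y‖ + ‖c y‖) S (by positivity)
  obtain ⟨K, hK⟩ := aux_lip hb (R + M)
  set G := gronwallBound 0 K 1 S with hG
  have hGε : ∀ ε, gronwallBound 0 K ε S = ε * G := by
    intro ε
    rw [hG]; unfold gronwallBound; split_ifs <;> ring
  have hG0 : 0 ≤ G := by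
    have := gronwallBound_mono (δ := 0) (K := K) (ε := 1) le_rfl zero_le_one K.2 hS
    rwa [gronwallBound_x0] at this
  have hd : HasDerivAt (fun h : ℝ => Y S (y + h • c y)) (fderiv ℝ (Y S) y (c y)) 0 := by
    have h1 : HasDerivAt (fun h : ℝ => y + h • c y) (c y) 0 := by
      simpa using ((hasDerivAt_id (0:ℝ)).smul_const (c y)).const_add y
    have h2 : HasFDerivAt (Y S) (fderiv ℝ (Y S) y) (y + (0:ℝ) • c y) := by
      simpa using ((hYs S).differentiable one_ne_zero y).hasFDerivAt
    exact h2.comp_hasDerivAt (0:ℝ) h1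
  refine hd.unique ?_
  rw [hasDerivAt_iff_isLittleO]
  rw [Asymptotics.isLittleO_iff]
  intro ε' hε'
  obtain ⟨η, hη, hu⟩ := aux_unif hb R (ε := ε' / ((M + 1) * (G + 1))) (by positivity)
  have hδ : 0 < min 1 (η / (M + 1)) := by positivity
  filter_upwards [Metric.ball_mem_nhds (0:ℝ) hδ] with h hh
  simp only [Metric.mem_ball, dist_zero_right, lt_min_iff, Real.norm_eq_abs] at hh
  obtain ⟨hh1, hh2⟩ := hh
  rw [lt_div_iff₀ (by positivity)] at hh2
  have hxR : ∀ t ∈ Set.Icc 0 S, ‖Y t y‖ ≤ R := hR (fun t => Y t y) (fun t => hYd t y) (by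
    simp only [hY0]; have := norm_nonneg (c y); linarith)
  have hxR' : ∀ t ∈ Set.Icc 0 S, ‖Y t (y + h • c y)‖ ≤ R :=
    hR (fun t => Y t (y + h • c y)) (fun t => hYd t _) (by
      simp only [hY0]
      refine (norm_add_le _ _).trans ?_
      rw [norm_smul, Real.norm_eq_abs]
      have := mul_le_of_le_one_left (norm_nonneg (c y)) hh1.le
      linarith)
  have hhe : ∀ t ∈ Set.Icc 0 S, ‖h • c (Y t y)‖ ≤ |h| * M := fun t ht => by
    rw [norm_smul, Real.norm_eq_abs]
    exact mul_le_mul_of_nonneg_left (hM t ht) (abs_nonneg h)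
  have hhM : |h| * M ≤ M := mul_le_of_le_one_left hM0 hh1.le
  have key := dist_le_of_approx_trajectories_ODE_of_mem (v := fun _ => b)
    (s := fun _ => Metric.closedBall 0 (R + M)) (K := K) (a := 0) (b := S)
    (f := fun t => Y t (y + h • c y)) (f' := fun t => b (Y t (y + h • c y)))
    (g := fun t => Y t y + h • c (Y t y))
    (g' := fun t => b (Y t y) + h • fderiv ℝ b (Y t y) (c (Y t y)))
    (εf := 0) (εg := ε' / ((M + 1) * (G + 1)) * (|h| * M)) (δ := 0)
    (fun _ _ => hK)
    (fun t _ => (hYd t _).continuousAt.continuousWithinAt)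
    (fun t _ => (hYd t _).hasDerivWithinAt)
    (fun t _ => by simp)
    (fun t ht => by
      have := hxR' t ⟨ht.1, ht.2.le⟩
      simp only [mem_closedBall_zero_iff]; linarith)
    (cx.add (ce.const_smul h)).continuousOn
    (fun t _ => by
      refine HasDerivAt.hasDerivWithinAt ((hYd t y).add (HasDerivAt.const_smul h ?_))
      rw [← hbr]
      exact ((hc.differentiable one_ne_zero _).hasFDerivAt).comp_hasDerivAt t (hYd t y))
    (fun t ht => by
      have ht' : t ∈ Set.Icc 0 S := ⟨ht.1, ht.2.le⟩
      have h1 := hu (Y t y) (by simpa using hxR t ht') (Y t y + h • c (Y t y)) (by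
        rw [add_sub_cancel_left]
        refine (hhe t ht').trans_lt ?_
        have := abs_nonneg h
        nlinarith)
      rw [add_sub_cancel_left, map_smul] at h1
      rw [dist_comm, dist_eq_norm, ← sub_sub]
      refine h1.trans (mul_le_mul_of_nonneg_left (hhe t ht') (by positivity)))
    (fun t ht => by
      have ht' : t ∈ Set.Icc 0 S := ⟨ht.1, ht.2.le⟩
      simp only [mem_closedBall_zero_iff]
      refine (norm_add_le _ _).trans (add_le_add (hxR t ht') ((hhe t ht').trans hhM)))
    (by simp [hY0]) S ⟨hS, le_rfl⟩
  rw [sub_zero, zero_add, hGε, dist_eq_norm, ← sub_sub] at key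
  simp only [zero_smul, add_zero, sub_zero]
  refine key.trans ?_
  rw [Real.norm_eq_abs]
  have : ε' / ((M + 1) * (G + 1)) * (|h| * M) * G = (ε' * |h|) * ((M * G) / ((M + 1) * (G + 1))) := by
    ring
  rw [this]
  refine mul_le_of_le_one_right (by positivity) ?_
  rw [div_le_one (by positivity)]
  nlinarith

lemma aux_push {b c : E → E} {C : ℝ} (hb : ContDiff ℝ 1 b) (hc : ContDiff ℝ 1 c)
    (hC : 0 < C) (hgrow : ∀ y, ‖b y‖ ≤ C * (1 + ‖y‖))
    (Y : ℝ → E → E) (hY0 : ∀ y, Y 0 y = y)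
    (hYd : ∀ (s : ℝ) (y : E), HasDerivAt (fun t => Y t y) (b (Y s y)) s)
    (hYs : ∀ s : ℝ, ContDiff ℝ 1 (Y s))
    (hbr : ∀ y, fderiv ℝ c y (b y) = fderiv ℝ b y (c y)) (S : ℝ) (y : E) :
    fderiv ℝ (Y S) y (c y) = c (Y S y) := by
  rcases le_total 0 S with hS | hS
  · exact aux_push_fwd hb hc hC hgrow Y hY0 hYd hYs hbr S hS y
  · have := aux_push_fwd (b := fun y => - b y) hb.neg hc hC (by simpa using hgrow)
      (fun s => Y (-s)) (by simpa using hY0)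
      (fun s y => by
        have h := (hYd (-s) y).scomp s (hasDerivAt_neg s)
        simpa [Function.comp_def] using h) (fun s => hYs (-s))
      (fun y => by
        have : fderiv ℝ (fun y => - b y) y = - fderiv ℝ b y := fderiv_fun_neg
        rw [this, map_neg, hbr]; rfl) (-S) (by linarith) y
    simpa using this

lemma aux_group {b : E → E} (hb : ContDiff ℝ 1 b)
    (Y : ℝ → E → E) (hY0 : ∀ y, Y 0 y = y)
    (hYd : ∀ (s : ℝ) (y : E), HasDerivAt (fun t => Y t y) (b (Y s y)) s) (s : ℝ) (y : E) :
    Y (-s) (Y s y) = y := by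
  have := aux_unique hb (x := fun t => Y t (Y s y)) (y := fun t => Y (t + s) y)
    (fun t => hYd t _) (fun t => (hYd (t + s) y).comp_add_const t s) (by simp [hY0])
  have := congrFun this (-s)
  simpa [hY0] using this

lemma aux_var {b : E → E} {C : ℝ} (hb : ContDiff ℝ 1 b)
    (hC : 0 < C) (hgrow : ∀ y, ‖b y‖ ≤ C * (1 + ‖y‖))
    (Y : ℝ → E → E) (hY0 : ∀ y, Y 0 y = y)
    (hYd : ∀ (s : ℝ) (y : E), HasDerivAt (fun t => Y t y) (b (Y s y)) s)
    (hYs : ∀ s : ℝ, ContDiff ℝ 1 (Y s)) (z w : E) :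
    HasDerivWithinAt (fun s => fderiv ℝ (Y s) z w) (fderiv ℝ b z w) (Set.Ici 0) 0 := by
  set D := ‖fderiv ℝ b z‖ with hD
  set L : NNReal := ‖fderiv ℝ b z‖₊ + 1 with hL
  have hLD : (L : ℝ) = D + 1 := by simp [hL, hD]
  have hD0 : 0 ≤ D := norm_nonneg _
  set A := Real.exp L with hA
  have hA0 : 0 < A := Real.exp_pos _
  obtain ⟨R, hR0, hR⟩ := aux_bound hC hgrow (‖z‖ + 1) 1 (by positivity)
  set B := C * (1 + R) with hB
  have hB0 : 0 ≤ B := by positivity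
  -- main estimate
  have main : ∀ ε > 0, ε ≤ 1 → ∃ δ > 0, δ ≤ 1 ∧ ∀ s ∈ Set.Icc 0 δ,
      ‖fderiv ℝ (Y s) z w - w - s • fderiv ℝ b z w‖ ≤ (ε * A + D * (L * A * s)) * ‖w‖ * s := by
    intro ε hε hε1
    have hst := (hb.contDiffAt (x := z)).hasStrictFDerivAt one_ne_zero
    have hst' := hst.isLittleO.def hε
    obtain ⟨η, hη, hst'⟩ := Metric.eventually_nhds_iff_ball.1 hst'
    have hst : ∀ p ∈ Metric.ball z η, ∀ q ∈ Metric.ball z η,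
        ‖b p - b q - fderiv ℝ b z (p - q)‖ ≤ ε * ‖p - q‖ := fun p hp q hq =>
      hst' (p, q) (by
        rw [← ball_prod_same]; exact ⟨hp, hq⟩)
    have hlip : LipschitzOnWith L b (Metric.ball z η) := by
      refine LipschitzOnWith.of_dist_le_mul fun p hp q hq => ?_
      rw [dist_eq_norm, dist_eq_norm, hLD]
      have h1 := hst p hp q hq
      have h2 := (fderiv ℝ b z).le_opNorm (p - q)
      have h3 := norm_le_norm_sub_add (b p - b q) (fderiv ℝ b z (p - q))
      have := norm_nonneg (p - q)
      nlinarith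
    set δ := min 1 (η / (2 * (B + 1))) with hδ
    have hδ0 : 0 < δ := by positivity
    refine ⟨δ, hδ0, min_le_left _ _, fun s hs => ?_⟩
    set ρ := min 1 (η / 2) with hρ
    have hρ0 : 0 < ρ := by positivity
    have hs1 : s ≤ 1 := hs.2.trans (min_le_left _ _)
    have hin : ∀ y ∈ Metric.ball z ρ, ∀ t ∈ Set.Icc 0 s, Y t y ∈ Metric.ball z η := by
      intro y hy t ht
      rw [mem_ball_iff_norm] at hy
      have hyR : ∀ t ∈ Set.Icc (0:ℝ) 1, ‖Y t y‖ ≤ R := hR (fun t => Y t y) (fun t => hYd t y) (by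
        simp only [hY0]
        have h3 := norm_le_norm_sub_add y z
        have := hy.le.trans (min_le_left _ _)
        linarith)
      have h1 := norm_image_sub_le_of_norm_deriv_le_segment' (f := fun t => Y t y)
        (f' := fun t => b (Y t y)) (C := B) (a := 0) (b := s)
        (fun t _ => (hYd t y).hasDerivWithinAt)
        (fun t ht => (hgrow _).trans (by
          have := hyR t ⟨ht.1, ht.2.le.trans hs1⟩
          rw [hB]; gcongr)) t ht
      simp only [hY0, sub_zero] at h1
      rw [mem_ball_iff_norm]
      have h2 : ‖Y t y - z‖ ≤ ‖Y t y - y‖ + ‖y - z‖ := norm_sub_le_norm_sub_add_norm_sub _ _ _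
      have h3 : t ≤ η / (2 * (B + 1)) := ht.2.trans (hs.2.trans (min_le_right _ _))
      rw [le_div_iff₀ (by positivity)] at h3
      have h4 := hy.trans_le (min_le_right _ _)
      have := ht.1
      nlinarith
    -- estimate for nearby points
    have est : ∀ y ∈ Metric.ball z ρ,
        ‖(Y s y - Y s z) - (y - z) - s • fderiv ℝ b z (y - z)‖
          ≤ (ε * A + D * (L * A * s)) * ‖y - z‖ * s := by
      intro y hy
      have iny := hin y hy
      have inz := hin z (Metric.mem_ball_self hρ0)
      have g1 : ∀ t ∈ Set.Icc 0 s, ‖Y t y - Y t z‖ ≤ A * ‖y - z‖ := by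
        intro t ht
        have := dist_le_of_trajectories_ODE_of_mem (v := fun _ => b) (s := fun _ => Metric.ball z η)
          (K := L) (a := 0) (b := s) (f := fun t => Y t y) (g := fun t => Y t z)
          (δ := ‖y - z‖) (fun _ _ => hlip) 
          (fun t _ => (hYd t _).continuousAt.continuousWithinAt)
          (fun t _ => (hYd t _).hasDerivWithinAt)
          (fun t ht => iny t ⟨ht.1, ht.2.le⟩)
          (fun t _ => (hYd t _).continuousAt.continuousWithinAt)
          (fun t _ => (hYd t _).hasDerivWithinAt)
          (fun t ht => inz t ⟨ht.1, ht.2.le⟩) (by simp [hY0, dist_eq_norm]) t ht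
        rw [dist_eq_norm, sub_zero] at this
        refine this.trans ?_
        rw [mul_comm, hA]
        gcongr
        exact mul_le_of_le_one_right L.2 (ht.2.trans hs1)
      have g2 : ∀ t ∈ Set.Icc 0 s, ‖(Y t y - Y t z) - (y - z)‖ ≤ L * A * s * ‖y - z‖ := by
        intro t ht
        have h1 := norm_image_sub_le_of_norm_deriv_le_segment' (f := fun t => Y t y - Y t z)
          (f' := fun t => b (Y t y) - b (Y t z)) (C := L * (A * ‖y - z‖)) (a := 0) (b := s)
          (fun t _ => ((hYd t y).sub (hYd t z)).hasDerivWithinAt)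
          (fun t ht => by
            have ht' : t ∈ Set.Icc 0 s := ⟨ht.1, ht.2.le⟩
            have := hlip.dist_le_mul _ (iny t ht') _ (inz t ht')
            rw [dist_eq_norm, dist_eq_norm] at this
            exact this.trans (mul_le_mul_of_nonneg_left (g1 t ht') L.2)) t ht
        simp only [hY0, sub_zero] at h1
        refine h1.trans ?_
        have : L * (A * ‖y - z‖) * t ≤ L * (A * ‖y - z‖) * s := by
          gcongr; exact ht.2
        linarith
      have h1 := norm_image_sub_le_of_norm_deriv_le_segment'
          (f := fun t => (Y t y - Y t z) - t • fderiv ℝ b z (y - z))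
          (f' := fun t => (b (Y t y) - b (Y t z)) - (1:ℝ) • fderiv ℝ b z (y - z))
          (C := (ε * A + D * (L * A * s)) * ‖y - z‖) (a := 0) (b := s)
          (fun t _ => (((hYd t y).sub (hYd t z)).sub
            ((hasDerivAt_id t).smul_const _)).hasDerivWithinAt)
          (fun t ht => by
            have ht' : t ∈ Set.Icc 0 s := ⟨ht.1, ht.2.le⟩
            have e1 := hst _ (iny t ht') _ (inz t ht')
            have e2 := (fderiv ℝ b z).le_opNorm ((Y t y - Y t z) - (y - z))
            have e3 := g1 t ht'
            have e4 := g2 t ht'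
            have e5 : (b (Y t y) - b (Y t z)) - (1:ℝ) • fderiv ℝ b z (y - z)
              = (b (Y t y) - b (Y t z) - fderiv ℝ b z (Y t y - Y t z))
                + fderiv ℝ b z ((Y t y - Y t z) - (y - z)) := by
              rw [map_sub _ (Y t y - Y t z) (y - z), one_smul]; abel
            rw [e5]
            refine (norm_add_le _ _).trans ?_
            have e6 := mul_le_mul_of_nonneg_left e3 hε.le
            have e7 := mul_le_mul_of_nonneg_left e4 hD0
            linarith) s ⟨hs.1, le_rfl⟩
      simp only [hY0, sub_zero, zero_smul] at h1
      rwa [sub_right_comm]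
    -- pass to the limit
    have hline : HasDerivAt (fun h : ℝ => z + h • w) w 0 := by
      simpa using ((hasDerivAt_id (0:ℝ)).smul_const w).const_add z
    have hd : HasDerivAt (fun h : ℝ => (Y s (z + h • w) - Y s z) - h • w - h • s • fderiv ℝ b z w)
        (fderiv ℝ (Y s) z w - w - s • fderiv ℝ b z w) 0 := by
      have h2 : HasFDerivAt (Y s) (fderiv ℝ (Y s) z) (z + (0:ℝ) • w) := by
        simpa using ((hYs s).differentiable one_ne_zero z).hasFDerivAt
      have h3 := h2.comp_hasDerivAt (0:ℝ) hline
      have h4 := ((h3.sub_const (Y s z)).sub ((hasDerivAt_id (0:ℝ)).smul_const w)).sub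
        ((hasDerivAt_id (0:ℝ)).smul_const (s • fderiv ℝ b z w))
      simp only [one_smul] at h4
      exact h4
    have hb0 : 0 ≤ (ε * A + D * (L * A * s)) * ‖w‖ * s := by
      have := hs.1
      positivity
    refine hd.le_of_lip' hb0 ?_
    have hcont : Filter.Tendsto (fun h : ℝ => z + h • w) (nhds 0) (nhds z) := by
      simpa using hline.continuousAt.tendsto
    filter_upwards [hcont (Metric.ball_mem_nhds z hρ0)] with h hh
    have := est _ hh
    simp only [add_sub_cancel_left, map_smul, norm_smul] at this
    simp only [zero_smul, add_zero, sub_self, sub_zero]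
    rw [smul_comm h s]
    refine this.trans (le_of_eq ?_)
    ring
  rw [hasDerivWithinAt_iff_isLittleO, Asymptotics.isLittleO_iff]
  intro κ hκ
  set N := (A + D * (L * A)) * ‖w‖ + 1 with hN
  have hN0 : 0 < N := by positivity
  obtain ⟨δ, hδ, hδ1, hm⟩ := main (min 1 (κ / N)) (by positivity) (min_le_left _ _)
  have hr : 0 < min δ (κ / N) := by positivity
  filter_upwards [mem_nhdsWithin_of_mem_nhds (Metric.ball_mem_nhds (0:ℝ) hr),
    self_mem_nhdsWithin] with s hs hs0
  simp only [Metric.mem_ball, dist_zero_right, lt_min_iff, Real.norm_eq_abs] at hs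
  simp only [Set.mem_Ici] at hs0
  rw [abs_of_nonneg hs0] at hs
  have h0 : fderiv ℝ (Y 0) z w = w := by
    have : Y 0 = id := funext hY0
    rw [this]; simp
  rw [h0, sub_zero, Real.norm_eq_abs, abs_of_nonneg hs0]
  refine (hm s ⟨hs0, hs.1.le⟩).trans ?_
  gcongr
  have e1 : min 1 (κ / N) ≤ κ / N := min_le_right _ _
  calc (min 1 (κ / N) * A + D * (L * A * s)) * ‖w‖
      ≤ (κ / N * A + D * (L * A * (κ / N))) * ‖w‖ := by
        gcongr; exact hs.2.le
    _ = κ / N * (N - 1) := by rw [hN]; ring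
    _ ≤ κ / N * N := by gcongr; linarith
    _ = κ := by field_simp

end ODE


section INT
variable {m : ℕ}

lemma aux_fund {f : (Fin m → ℝ) → ℝ} (hf : Continuous f)
    (h : ∀ v : (Fin m → ℝ) → ℝ, ContDiff ℝ 1 v → HasCompactSupport v → ∫ y, f y * v y = 0) (y : Fin m → ℝ) :
    f y = 0 := by
  have h1 : ∀ᵐ x, f x = 0 := by
    refine ae_eq_zero_of_integral_contDiff_smul_eq_zero hf.locallyIntegrable fun g hg hgs => ?_
    rw [← h g (hg.of_le (by exact_mod_cast le_top)) hgs]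
    congr 1; funext y; simp [mul_comm]
  have h2 : f = fun _ => 0 := (Continuous.ae_eq_iff_eq volume hf continuous_const).1 h1
  exact congrFun h2 y

lemma aux_test (z : Fin m → ℝ) (i : Fin m) : ∃ u : (Fin m → ℝ) → ℝ, ContDiff ℝ 2 u ∧
    HasCompactSupport u ∧ ∀ w, fderiv ℝ u z w = w i := by
  let χ : ContDiffBump z := ⟨1, 2, one_pos, one_lt_two⟩
  refine ⟨fun y => χ y * y i, χ.contDiff.mul (contDiff_apply ℝ ℝ i), χ.hasCompactSupport.mul_right, fun w => ?_⟩
  have : (fun y => χ y * y i) =ᶠ[nhds z] fun y => y i := by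
    filter_upwards [χ.eventuallyEq_one] with y hy
    simp [hy]
  rw [this.fderiv_eq]
  have : HasFDerivAt (fun y : Fin m → ℝ => y i) (ContinuousLinearMap.proj (R := ℝ) (φ := fun _ => ℝ) i) z :=
    (ContinuousLinearMap.proj (R := ℝ) (φ := fun _ => ℝ) i).hasFDerivAt
  rw [this.fderiv]; rfl

lemma aux_div {b : (Fin m → ℝ) → (Fin m → ℝ)} (hb : ContDiff ℝ 1 b)
    (hdivb : ∀ y, ∑ i, fderiv ℝ (fun z => b z i) y (Pi.single i (1:ℝ)) = 0)
    {w : (Fin m → ℝ) → ℝ} (hw : ContDiff ℝ 1 w) (hws : HasCompactSupport w) :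
    ∫ y, fderiv ℝ w y (b y) = 0 := by
  have hbi : ∀ i, ContDiff ℝ 1 (fun z => b z i) := fun i => contDiff_pi.1 hb i
  have cw : ∀ v, Continuous fun y => fderiv ℝ w y v := fun v =>
    (hw.continuous_fderiv one_ne_zero).clm_apply continuous_const
  have cb : ∀ i v, Continuous fun y => fderiv ℝ (fun z => b z i) y v := fun i v =>
    ((hbi i).continuous_fderiv one_ne_zero).clm_apply continuous_const
  have sw : ∀ v, HasCompactSupport fun y => fderiv ℝ w y v := fun v => hws.fderiv_apply ℝ v
  have I1 : ∀ i, Integrable (fun y => fderiv ℝ w y (Pi.single i 1) * b y i) := fun i =>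
    ((cw _).mul (hbi i).continuous).integrable_of_hasCompactSupport (sw _).mul_right
  have I2 : ∀ i, Integrable (fun y => w y * fderiv ℝ (fun z => b z i) y (Pi.single i 1)) := fun i =>
    (hw.continuous.mul (cb _ _)).integrable_of_hasCompactSupport hws.mul_right
  have I3 : ∀ i, Integrable (fun y => w y * b y i) := fun i =>
    (hw.continuous.mul (hbi i).continuous).integrable_of_hasCompactSupport hws.mul_right
  have e : ∀ y, fderiv ℝ w y (b y) = ∑ i, fderiv ℝ w y (Pi.single i 1) * b y i := by
    intro y
    conv_lhs => rw [pi_eq_sum_univ' (b y)]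
    rw [map_sum]
    refine Finset.sum_congr rfl fun i _ => ?_
    rw [map_smul, smul_eq_mul, mul_comm]
  simp_rw [e]
  rw [integral_finset_sum _ fun i _ => I1 i]
  have ibp : ∀ i, ∫ y, fderiv ℝ w y (Pi.single i 1) * b y i
      = - ∫ y, w y * fderiv ℝ (fun z => b z i) y (Pi.single i 1) := fun i => by
    rw [integral_mul_fderiv_eq_neg_fderiv_mul_of_integrable (I1 i) (I2 i) (I3 i)
      (fun x _ => hw.differentiable one_ne_zero x)
      (fun x _ => (hbi i).differentiable one_ne_zero x), neg_neg]
  simp_rw [ibp]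
  rw [Finset.sum_neg_distrib, ← integral_finset_sum _ fun i _ => I2 i]
  simp_rw [← Finset.mul_sum, hdivb]
  simp

lemma aux_weak {b c : (Fin m → ℝ) → (Fin m → ℝ)} (hb : ContDiff ℝ 1 b) (hc : ContDiff ℝ 1 c)
    (hdivb : ∀ y, ∑ i, fderiv ℝ (fun z => b z i) y (Pi.single i (1:ℝ)) = 0)
    {u v : (Fin m → ℝ) → ℝ} (hu : ContDiff ℝ 2 u) (hus : HasCompactSupport u)
    (hv : ContDiff ℝ 1 v) (hvs : HasCompactSupport v) :
    (∫ y, fderiv ℝ u y (c y) * fderiv ℝ v y (b y))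
      + (∫ y, fderiv ℝ (fun z => fderiv ℝ u z (b z)) y (c y) * v y)
    = - ∫ y, fderiv ℝ u y (fderiv ℝ c y (b y) - fderiv ℝ b y (c y)) * v y := by
  have hu' : ContDiff ℝ 1 (fderiv ℝ u) := hu.fderiv_right (by norm_num)
  have hbu : ContDiff ℝ 1 (fun z => fderiv ℝ u z (b z)) := hu'.clm_apply hb
  have hcu : ContDiff ℝ 1 (fun z => fderiv ℝ u z (c z)) := hu'.clm_apply hc
  have dd : ∀ (a : (Fin m → ℝ) → (Fin m → ℝ)), ContDiff ℝ 1 a → ∀ y w,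
      fderiv ℝ (fun z => fderiv ℝ u z (a z)) y w
        = fderiv ℝ (fderiv ℝ u) y w (a y) + fderiv ℝ u y (fderiv ℝ a y w) := by
    intro a ha y w
    rw [fderiv_clm_apply (hu'.differentiable one_ne_zero y) (ha.differentiable one_ne_zero y)]
    simp [add_comm]
  have key : ∀ y, fderiv ℝ u y (c y) * fderiv ℝ v y (b y)
      + fderiv ℝ (fun z => fderiv ℝ u z (b z)) y (c y) * v y
      = fderiv ℝ (fun z => fderiv ℝ u z (c z) * v z) y (b y)
        - fderiv ℝ u y (fderiv ℝ c y (b y) - fderiv ℝ b y (c y)) * v y := by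
    intro y
    have sym : fderiv ℝ (fderiv ℝ u) y (c y) (b y) = fderiv ℝ (fderiv ℝ u) y (b y) (c y) :=
      (hu.contDiffAt (x := y)).isSymmSndFDerivAt (by simp) _ _
    rw [fderiv_fun_mul (hcu.differentiable one_ne_zero y) (hv.differentiable one_ne_zero y)]
    simp only [ContinuousLinearMap.add_apply, ContinuousLinearMap.smul_apply, smul_eq_mul, dd b hb, dd c hc, map_sub, sym]
    ring
  have cub : Continuous fun y => fderiv ℝ v y (b y) :=
    (hv.continuous_fderiv one_ne_zero).clm_apply hb.continuous
  have cfu : ∀ a : (Fin m → ℝ) → (Fin m → ℝ), Continuous a → Continuous fun y => fderiv ℝ u y (a y) :=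
    fun a ha => hu'.continuous.clm_apply ha
  have cbr : Continuous fun y => fderiv ℝ c y (b y) - fderiv ℝ b y (c y) :=
    ((hc.continuous_fderiv one_ne_zero).clm_apply hb.continuous).sub
      ((hb.continuous_fderiv one_ne_zero).clm_apply hc.continuous)
  have svb : HasCompactSupport fun y => fderiv ℝ v y (b y) := by
    refine (hvs.fderiv ℝ).mono' ?_
    intro y hy
    refine subset_tsupport _ ?_
    intro h0
    exact hy (by simp [h0])
  have J1 : Integrable (fun y => fderiv ℝ u y (c y) * fderiv ℝ v y (b y)) :=
    ((cfu c hc.continuous).mul cub).integrable_of_hasCompactSupport svb.mul_left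
  have J2 : Integrable (fun y => fderiv ℝ (fun z => fderiv ℝ u z (b z)) y (c y) * v y) :=
    (((hbu.continuous_fderiv one_ne_zero).clm_apply hc.continuous).mul
      hv.continuous).integrable_of_hasCompactSupport hvs.mul_left
  have J3 : Integrable (fun y => fderiv ℝ u y (fderiv ℝ c y (b y) - fderiv ℝ b y (c y)) * v y) :=
    ((cfu _ cbr).mul hv.continuous).integrable_of_hasCompactSupport hvs.mul_left
  have J4 : Integrable (fun y => fderiv ℝ (fun z => fderiv ℝ u z (c z) * v z) y (b y)) := by
    have := (J1.add J2).add J3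
    refine this.congr (Filter.Eventually.of_forall fun y => ?_)
    have := key y
    simp only [Pi.add_apply]
    linarith
  rw [← integral_add J1 J2]
  simp_rw [key]
  rw [integral_sub J4 J3, aux_div hb hdivb (hcu.mul hv) hvs.mul_left, zero_sub]

end INT



/-- Let `b` be a `C¹`, divergence-free vector field on `ℝ^m` with linear
growth and measure-preserving global flow `Y`, and let `c` be a `C¹` vector field.  The
following are equivalent:
(1) the Poisson bracket `[b,c] = (b·∇_y)c − (∂_y b)c` vanishes identically;
(2) for every `s ∈ ℝ` and all `u, v ∈ C¹_c(ℝ^m)`,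
    `∫ (c·∇_y u)(y) v(Y(−s;y)) dy = ∫ (c·∇_y (u∘Y(s;·)))(y) v(y) dy`;
(3) for every `u ∈ C²_c(ℝ^m)` and `v ∈ C¹_c(ℝ^m)`,
    `∫ (c·∇_y u)(b·∇_y v) dy + ∫ (c·∇_y(b·∇_y u)) v dy = 0`. -/
theorem vector_field_involution_weak_characterizations
    (m : ℕ) (hm : 1 ≤ m)
    (b : (Fin m → ℝ) → (Fin m → ℝ)) (hb : ContDiff ℝ 1 b)
    (C : ℝ) (hC : 0 < C) (hgrow : ∀ y, ‖b y‖ ≤ C * (1 + ‖y‖))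
    (hdivb : ∀ y, ∑ i, fderiv ℝ (fun z => b z i) y (Pi.single i (1:ℝ)) = 0)
    (Y : ℝ → (Fin m → ℝ) → (Fin m → ℝ))
    (hY0 : ∀ y, Y 0 y = y)
    (hYd : ∀ (s : ℝ) (y : Fin m → ℝ), HasDerivAt (fun t => Y t y) (b (Y s y)) s)
    (hYs : ∀ s : ℝ, ContDiff ℝ 1 (Y s))
    (hYmp : ∀ s : ℝ, MeasurePreserving (Y s) (volume : Measure (Fin m → ℝ)) volume)
    (c : (Fin m → ℝ) → (Fin m → ℝ)) (hc : ContDiff ℝ 1 c) :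
    ((∀ y, fderiv ℝ c y (b y) - fderiv ℝ b y (c y) = 0) ↔
      (∀ (s : ℝ) (u v : (Fin m → ℝ) → ℝ),
        ContDiff ℝ 1 u → HasCompactSupport u → ContDiff ℝ 1 v → HasCompactSupport v →
        ∫ y, fderiv ℝ u y (c y) * v (Y (-s) y) ∂(volume : Measure (Fin m → ℝ))
          = ∫ y, fderiv ℝ (fun z => u (Y s z)) y (c y) * v y
              ∂(volume : Measure (Fin m → ℝ)))) ∧
    ((∀ y, fderiv ℝ c y (b y) - fderiv ℝ b y (c y) = 0) ↔
      (∀ u v : (Fin m → ℝ) → ℝ,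
        ContDiff ℝ 2 u → HasCompactSupport u → ContDiff ℝ 1 v → HasCompactSupport v →
        (∫ y, fderiv ℝ u y (c y) * fderiv ℝ v y (b y) ∂(volume : Measure (Fin m → ℝ)))
          + (∫ y, fderiv ℝ (fun z => fderiv ℝ u z (b z)) y (c y) * v y
              ∂(volume : Measure (Fin m → ℝ))) = 0)) := by

  have cbr : Continuous fun y => fderiv ℝ c y (b y) - fderiv ℝ b y (c y) :=
    ((hc.continuous_fderiv one_ne_zero).clm_apply hb.continuous).sub
      ((hb.continuous_fderiv one_ne_zero).clm_apply hc.continuous)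
  have cv : ∀ (s : ℝ) (u v : (Fin m → ℝ) → ℝ), ContDiff ℝ 1 u → ContDiff ℝ 1 v →
      ∫ y, fderiv ℝ u y (c y) * v (Y (-s) y)
        = ∫ y, fderiv ℝ u (Y s y) (c (Y s y)) * v y := by
    intro s u v hu hv
    have cg : Continuous fun y => fderiv ℝ u y (c y) * v (Y (-s) y) :=
      ((hu.continuous_fderiv one_ne_zero).clm_apply hc.continuous).mul
        (hv.continuous.comp (hYs (-s)).continuous)
    conv_lhs => rw [← (hYmp s).map_eq]
    rw [integral_map (hYmp s).measurable.aemeasurable cg.aestronglyMeasurable]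
    simp_rw [aux_group hb Y hY0 hYd]
  have chain : ∀ (s : ℝ) (u : (Fin m → ℝ) → ℝ), ContDiff ℝ 1 u → ∀ y w,
      fderiv ℝ (fun z => u (Y s z)) y w = fderiv ℝ u (Y s y) (fderiv ℝ (Y s) y w) := by
    intro s u hu y w
    have := fderiv_comp y (hu.differentiable one_ne_zero (Y s y))
      ((hYs s).differentiable one_ne_zero y)
    have h2 : (fun z => u (Y s z)) = u ∘ Y s := rfl
    rw [h2, this]; rfl
  refine ⟨⟨fun hbr s u v hu hus hv hvs => ?_, fun h => ?_⟩,
    ⟨fun hbr u v hu hus hv hvs => ?_, fun h z => ?_⟩⟩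
  · rw [cv s u v hu hv]
    simp_rw [chain s u hu, aux_push hb hc hC hgrow Y hY0 hYd hYs (fun y => sub_eq_zero.1 (hbr y))]
  · have hp : ∀ s z, fderiv ℝ (Y s) z (c z) = c (Y s z) := by
      intro s z
      funext i
      obtain ⟨u, hu2, hus, hui⟩ := aux_test (Y s z) i
      have hu : ContDiff ℝ 1 u := hu2.of_le one_le_two
      have c1 : Continuous fun y => fderiv ℝ u (Y s y) (fderiv ℝ (Y s) y (c y)) :=
        ((hu.continuous_fderiv one_ne_zero).comp (hYs s).continuous).clm_apply
          (((hYs s).continuous_fderiv one_ne_zero).clm_apply hc.continuous)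
      have c2 : Continuous fun y => fderiv ℝ u (Y s y) (c (Y s y)) :=
        ((hu.continuous_fderiv one_ne_zero).comp (hYs s).continuous).clm_apply
          (hc.continuous.comp (hYs s).continuous)
      have := aux_fund (f := fun y => fderiv ℝ u (Y s y) (fderiv ℝ (Y s) y (c y)) - fderiv ℝ u (Y s y) (c (Y s y)))
        (c1.sub c2) (fun v hv hvs => by
        have e := h s u v hu hus hv hvs
        rw [cv s u v hu hv] at e
        simp_rw [chain s u hu] at e
        simp only [sub_mul]
        have i1 : Integrable (fun y => fderiv ℝ u (Y s y) (fderiv ℝ (Y s) y (c y)) * v y) :=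
          (c1.mul hv.continuous).integrable_of_hasCompactSupport hvs.mul_left
        have i2 : Integrable (fun y => fderiv ℝ u (Y s y) (c (Y s y)) * v y) :=
          (c2.mul hv.continuous).integrable_of_hasCompactSupport hvs.mul_left
        rw [integral_sub i1 i2, e, sub_self]) z
      simp only [hui] at this
      exact sub_eq_zero.1 this
    intro z
    have d1 := aux_var hb hC hgrow Y hY0 hYd hYs z (c z)
    have d2 : HasDerivWithinAt (fun s => fderiv ℝ (Y s) z (c z)) (fderiv ℝ c z (b z))
        (Set.Ici 0) 0 := by
      simp_rw [hp]
      have h1 := ((hc.differentiable one_ne_zero (Y 0 z)).hasFDerivAt).comp_hasDerivAt 0 (hYd 0 z)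
      rw [hY0] at h1
      exact h1.hasDerivWithinAt
    rw [sub_eq_zero]
    exact ((uniqueDiffOn_Ici (0:ℝ)) 0 Set.self_mem_Ici).eq_deriv _ d2 d1
  · rw [aux_weak hb hc hdivb hu hus hv hvs]
    simp [hbr]
  · funext i
    obtain ⟨u, hu, hus, hui⟩ := aux_test z i
    have cf : Continuous fun y => fderiv ℝ u y (fderiv ℝ c y (b y) - fderiv ℝ b y (c y)) :=
      (hu.continuous_fderiv two_ne_zero).clm_apply cbr
    have := aux_fund cf (fun v hv hvs => by
      have e := h u v hu hus hv hvs
      rw [aux_weak hb hc hdivb hu hus hv hvs] at e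
      exact neg_eq_zero.1 e) z
    rw [hui] at this
    exact this
end

section
/- Let b : ℝ^m → ℝ^m be a C² divergence-free vector field and A : ℝ^m → M_m(ℝ) a C² matrix field. Then for every u ∈ C³(ℝ^m) there holds pointwise on ℝ^m: b·∇_y(div_y(A ∇_y u)) − div_y(A ∇_y(b·∇_y u)) = div_y([b,A] ∇_y u), where [b,A] := (b·∇_y)A − (∂_yb) A − A ᵗ(∂_yb) (the directional derivative b·∇_y acting entrywise on A). -/
open MeasureTheory Matrix

theorem vf_symm {m : ℕ} {f : (Fin m → ℝ) → ℝ} (hf : ContDiff ℝ 2 f) (y v w : Fin m → ℝ) :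
    fderiv ℝ (fderiv ℝ f) y v w = fderiv ℝ (fderiv ℝ f) y w v :=
  (hf.contDiffAt.isSymmSndFDerivAt (by simp)) v w

theorem vf_dd {m : ℕ} {f : (Fin m → ℝ) → ℝ} (hf : ContDiff ℝ 2 f) :
    Differentiable ℝ (fderiv ℝ f) :=
  (hf.fderiv_right (m := 1) (by norm_num)).differentiable (by norm_num)

theorem vf_exp {m : ℕ} (L : (Fin m → ℝ) →L[ℝ] ℝ) (v : Fin m → ℝ) :
    L v = ∑ k, v k * L (Pi.single k (1:ℝ)) := by
  have h : v = ∑ k, v k • (Pi.single k (1:ℝ) : Fin m → ℝ) := by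
    ext j
    simp [Finset.sum_apply, Pi.single_apply]
  conv_lhs => rw [h]
  simp [map_sum]

theorem vf_const {m : ℕ} {f : (Fin m → ℝ) → ℝ} (hf : ContDiff ℝ 2 f) (y v w : Fin m → ℝ) :
    fderiv ℝ (fun z => fderiv ℝ f z w) y v = fderiv ℝ (fderiv ℝ f) y v w := by
  rw [fderiv_clm_apply (vf_dd hf y) (by fun_prop)]
  simp

theorem vf_along {m : ℕ} {f : (Fin m → ℝ) → ℝ} (hf : ContDiff ℝ 2 f)
    {b : (Fin m → ℝ) → (Fin m → ℝ)} (hb : Differentiable ℝ b) (y v : Fin m → ℝ) :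
    fderiv ℝ (fun z => fderiv ℝ f z (b z)) y v = fderiv ℝ (fderiv ℝ f) y v (b y)
      + ∑ k, fderiv ℝ (fun z => b z k) y v * fderiv ℝ f y (Pi.single k (1:ℝ)) := by
  rw [fderiv_clm_apply (vf_dd hf y) (hb y)]
  have h : ∀ k, fderiv ℝ (fun z => b z k) y v = fderiv ℝ b y v k := by
    intro k
    rw [fderiv_apply (hb y)]
    simp
  simp only [h, ContinuousLinearMap.add_apply, ContinuousLinearMap.comp_apply,
    ContinuousLinearMap.flip_apply]
  rw [vf_exp (fderiv ℝ f y) (fderiv ℝ b y v)]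
  ring

theorem vf_div {m : ℕ} (b : (Fin m → ℝ) → (Fin m → ℝ)) (hb : ContDiff ℝ 2 b)
    (hdivb : ∀ y, ∑ i, fderiv ℝ (fun z => b z i) y (Pi.single i (1:ℝ)) = 0)
    (ξ : Fin m → (Fin m → ℝ) → ℝ) (hξ : ∀ i, ContDiff ℝ 2 (ξ i)) (y : Fin m → ℝ) :
    fderiv ℝ (fun z => ∑ i, fderiv ℝ (ξ i) z (Pi.single i (1:ℝ))) y (b y)
    = ∑ i, fderiv ℝ (fun w => fderiv ℝ (ξ i) w (b w)
        - ∑ k, fderiv ℝ (fun z => b z i) w (Pi.single k (1:ℝ)) * ξ k w) y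
          (Pi.single i (1:ℝ)) := by
  have hbd : Differentiable ℝ b := hb.differentiable (by norm_num)
  have hbi : ∀ i, ContDiff ℝ 2 (fun z => b z i) := fun i => contDiff_pi.1 hb i
  have hξd : ∀ i, Differentiable ℝ (ξ i) := fun i => (hξ i).differentiable (by norm_num)
  have d1 : ∀ i, Differentiable ℝ (fderiv ℝ (ξ i)) := fun i => vf_dd (hξ i)
  have d2 : ∀ i, Differentiable ℝ (fderiv ℝ (fun z => b z i)) := fun i => vf_dd (hbi i)
  have e1 : ∀ i v, Differentiable ℝ (fun z => fderiv ℝ (ξ i) z v) := fun i v => by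
    have := d1 i
    fun_prop
  have e2 : ∀ i v, Differentiable ℝ (fun w => fderiv ℝ (fun z => b z i) w v) := fun i v =>
    (d2 i).clm_apply (differentiable_const v)
  have e3 : ∀ i, Differentiable ℝ (fun z => fderiv ℝ (ξ i) z (b z)) := fun i =>
    (d1 i).clm_apply hbd
  have hz : ∀ k, ∑ i, fderiv ℝ (fderiv ℝ (fun z => b z i)) y (Pi.single i (1:ℝ))
      (Pi.single k (1:ℝ)) = 0 := by
    intro k
    have h0 : fderiv ℝ (fun w => ∑ i, fderiv ℝ (fun z => b z i) w (Pi.single i (1:ℝ))) y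
        (Pi.single k (1:ℝ)) = 0 := by
      simp only [hdivb]
      simp
    rw [fderiv_fun_sum (fun i _ => e2 i _ y), ContinuousLinearMap.sum_apply] at h0
    rw [← h0]
    refine Finset.sum_congr rfl fun i _ => ?_
    rw [vf_const (hbi i), vf_symm (hbi i)]
  rw [fderiv_fun_sum (fun i _ => e1 i _ y), ContinuousLinearMap.sum_apply]
  have key : ∀ i, fderiv ℝ (fun w => fderiv ℝ (ξ i) w (b w)
        - ∑ k, fderiv ℝ (fun z => b z i) w (Pi.single k (1:ℝ)) * ξ k w) y
          (Pi.single i (1:ℝ)) =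
      fderiv ℝ (fderiv ℝ (ξ i)) y (b y) (Pi.single i (1:ℝ))
      + ∑ k, fderiv ℝ (fun z => b z k) y (Pi.single i (1:ℝ)) * fderiv ℝ (ξ i) y (Pi.single k (1:ℝ))
      - (∑ k, fderiv ℝ (fun z => b z i) y (Pi.single k (1:ℝ)) * fderiv ℝ (ξ k) y (Pi.single i (1:ℝ))
      + ∑ k, ξ k y * fderiv ℝ (fderiv ℝ (fun z => b z i)) y (Pi.single i (1:ℝ))
      (Pi.single k (1:ℝ))) := by
    intro i
    rw [fderiv_fun_sub (e3 i y)
      (DifferentiableAt.fun_sum fun k _ => (e2 i (Pi.single k (1:ℝ)) y).fun_mul (hξd k y)),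
      fderiv_fun_sum (fun k _ => (e2 i (Pi.single k (1:ℝ)) y).fun_mul (hξd k y)), ContinuousLinearMap.sub_apply,
      vf_along (hξ i) hbd, ContinuousLinearMap.sum_apply, vf_symm (hξ i), ← Finset.sum_add_distrib]
    congr 1
    refine Finset.sum_congr rfl fun k _ => ?_
    rw [fderiv_fun_mul (e2 i _ y) (hξd k y), ← vf_const (hbi i)]
    simp
  simp only [key, Finset.sum_sub_distrib, Finset.sum_add_distrib]
  have z2 : ∑ i, ∑ k, ξ k y * fderiv ℝ (fderiv ℝ (fun z => b z i)) y (Pi.single i (1:ℝ))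
      (Pi.single k (1:ℝ)) = 0 := by
    rw [Finset.sum_comm]
    simp only [← Finset.mul_sum, hz]
    simp
  rw [z2, Finset.sum_comm (f := fun i k => fderiv ℝ (fun z => b z i) y (Pi.single k (1:ℝ)) *
    fderiv ℝ (ξ k) y (Pi.single i (1:ℝ)))]
  simp only [vf_const (hξ _)]
  ring

/-- Let `b` be a `C²` divergence-free vector field and `A` a `C²` matrix
field on `ℝ^m`.  For every `u ∈ C³(ℝ^m)` there holds pointwise
`b·∇_y(div_y(A ∇_y u)) − div_y(A ∇_y(b·∇_y u)) = div_y([b,A] ∇_y u)`, where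
`[b,A] = (b·∇_y)A − (∂_y b) A − A ᵗ(∂_y b)` (with `b·∇_y` acting entrywise on `A`). -/
theorem commutator_transport_second_order
    (m : ℕ) (hm : 1 ≤ m)
    (b : (Fin m → ℝ) → (Fin m → ℝ)) (hb : ContDiff ℝ 2 b)
    (hdivb : ∀ y, ∑ i, fderiv ℝ (fun z => b z i) y (Pi.single i (1:ℝ)) = 0)
    (A : (Fin m → ℝ) → Matrix (Fin m) (Fin m) ℝ)
    (hA : ∀ i j, ContDiff ℝ 2 (fun y => A y i j)) :
    ∀ u : (Fin m → ℝ) → ℝ, ContDiff ℝ 3 u → ∀ y : Fin m → ℝ,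
      fderiv ℝ (fun z =>
          ∑ i, fderiv ℝ (fun w => ∑ j, A w i j * fderiv ℝ u w (Pi.single j (1:ℝ))) z
            (Pi.single i (1:ℝ))) y (b y)
      - (∑ i, fderiv ℝ (fun w =>
          ∑ j, A w i j * fderiv ℝ (fun z => fderiv ℝ u z (b z)) w (Pi.single j (1:ℝ))) y
            (Pi.single i (1:ℝ)))
      = ∑ i, fderiv ℝ (fun w =>
          ∑ j, (fderiv ℝ (fun z => A z i j) w (b w)
                - (∑ k, fderiv ℝ (fun z => b z i) w (Pi.single k (1:ℝ)) * A w k j)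
                - (∑ k, A w i k * fderiv ℝ (fun z => b z j) w (Pi.single k (1:ℝ))))
              * fderiv ℝ u w (Pi.single j (1:ℝ))) y (Pi.single i (1:ℝ)) := by
  intro u hu y
  have hbd : Differentiable ℝ b := hb.differentiable (by norm_num)
  have hbi : ∀ i, ContDiff ℝ 2 (fun z => b z i) := fun i => contDiff_pi.1 hb i
  have hu2 : ContDiff ℝ 2 u := hu.of_le (by norm_num)
  have hdu : ContDiff ℝ 2 (fderiv ℝ u) := hu.fderiv_right (by norm_num)
  have hdue : ∀ j, ContDiff ℝ 2 (fun w => fderiv ℝ u w (Pi.single j (1:ℝ))) := fun j =>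
    hdu.clm_apply contDiff_const
  have hξ : ∀ i, ContDiff ℝ 2 (fun w => ∑ j, A w i j * fderiv ℝ u w (Pi.single j (1:ℝ))) :=
    fun i => ContDiff.sum fun j _ => (hA i j).mul (hdue j)
  rw [vf_div b hb hdivb (fun i w => ∑ j, A w i j * fderiv ℝ u w (Pi.single j (1:ℝ))) hξ y,
    ← Finset.sum_sub_distrib]
  refine Finset.sum_congr rfl fun i _ => ?_
  have hbu : ContDiff ℝ 2 (fun z => fderiv ℝ u z (b z)) := hdu.clm_apply hb
  have c1 : ∀ {f : (Fin m → ℝ) → ℝ}, ContDiff ℝ 2 f → ContDiff ℝ 1 (fderiv ℝ f) :=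
    fun hf => hf.fderiv_right (by norm_num)
  have g1 : ContDiff ℝ 1 (fun w =>
      fderiv ℝ (fun w => ∑ j, A w i j * fderiv ℝ u w (Pi.single j (1:ℝ))) w (b w)
        - ∑ k, fderiv ℝ (fun z => b z i) w (Pi.single k (1:ℝ)) *
          ∑ j, A w k j * fderiv ℝ u w (Pi.single j (1:ℝ))) :=
    ((c1 (hξ i)).clm_apply (hb.of_le (by norm_num))).sub
      (ContDiff.sum fun k _ => ((c1 (hbi i)).clm_apply contDiff_const).mul
        ((hξ k).of_le (by norm_num)))
  have g2 : ContDiff ℝ 1 (fun w =>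
      ∑ j, A w i j * fderiv ℝ (fun z => fderiv ℝ u z (b z)) w (Pi.single j (1:ℝ))) :=
    ContDiff.sum fun j _ => ((hA i j).of_le (by norm_num)).mul
      ((c1 hbu).clm_apply contDiff_const)
  rw [← ContinuousLinearMap.sub_apply, ← fderiv_fun_sub (g1.differentiable (by norm_num) y)
    (g2.differentiable (by norm_num) y)]
  congr 2
  funext w
  have p : ∀ j, DifferentiableAt ℝ (fun y => A y i j) w := fun j =>
    (hA i j).differentiable (by norm_num) w
  have q : ∀ j, DifferentiableAt ℝ (fun w => fderiv ℝ u w (Pi.single j (1:ℝ))) w := fun j =>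
    (hdue j).differentiable (by norm_num) w
  rw [fderiv_fun_sum (fun j _ => (p j).fun_mul (q j)), ContinuousLinearMap.sum_apply]
  have r : ∀ j, fderiv ℝ (fun w => A w i j * fderiv ℝ u w (Pi.single j (1:ℝ))) w (b w) =
      A w i j * fderiv ℝ (fderiv ℝ u) w (Pi.single j (1:ℝ)) (b w)
      + fderiv ℝ (fun z => A z i j) w (b w) * fderiv ℝ u w (Pi.single j (1:ℝ)) := by
    intro j
    rw [fderiv_fun_mul (p j) (q j), vf_symm hu2, ← vf_const hu2]
    simp [mul_comm]
  simp only [r, vf_along hu2 hbd, sub_mul, mul_add, Finset.sum_add_distrib,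
    Finset.sum_sub_distrib, Finset.mul_sum, Finset.sum_mul]
  rw [Finset.sum_comm (f := fun j k => fderiv ℝ (fun z => b z i) w (Pi.single k (1:ℝ)) * A w k j *
      fderiv ℝ u w (Pi.single j (1:ℝ))),
    Finset.sum_comm (f := fun j k => A w i k * fderiv ℝ (fun z => b z j) w (Pi.single k (1:ℝ)) *
      fderiv ℝ u w (Pi.single j (1:ℝ)))]
  simp only [mul_assoc]
  ring
end
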